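/- Let ε > 0, let s ∈ ℂ with Re s < ε, and let c be a nonzero real number. Then the improper integral (1/(2π)) lim_{R→∞} ∫_{−R}^{R} e^{(ε+iu)c} / (ε + iu − s) du exists and equals e^{sc} if c > 0, and equals 0 if c < 0. Equivalently, the contour integral (1/(2πi)) ∫_{iℝ+ε} e^{ξc}/(ξ − s) dξ, taken as a principal-value limit along the vertical line Re ξ = ε, equals e^{sc}·χ_{(0,∞)}(c). -/

import Mathlib

open Filter Topology MeasureTheory
lemma ne0 {a : ℂ} (ha : 0 < a.re) (u : ℝ) : a + (u:ℂ) * Complex.I ≠ 0 := by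
  intro h
  have := congrArg Complex.re h
  simp at this
  linarith

lemma integ2 {a : ℂ} (ha : 0 < a.re) :
    Integrable (fun u : ℝ => 1 / (a + (u:ℂ) * Complex.I)^2) := by
  have h1 := ((integrable_inv_one_add_sq.comp_div ha.ne').comp_add_right a.im).const_mul ((a.re^2)⁻¹)
  refine h1.mono' ?_ (ae_of_all _ fun u => ?_)
  · refine Continuous.aestronglyMeasurable ?_
    refine continuous_const.div (by fun_prop) fun u => pow_ne_zero 2 (ne0 ha u)
  · have : ‖a + (u:ℂ) * Complex.I‖^2 = a.re^2 + (u + a.im)^2 := by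
      rw [← Complex.normSq_eq_norm_sq, Complex.normSq_apply]; simp; ring
    rw [norm_div, norm_pow, this, norm_one, ← mul_inv, mul_add, div_pow, mul_div_cancel₀ _ (by positivity)]
    simp

lemma expmul_tendsto {b : ℂ} (hb : 0 < b.re) :
    Tendsto (fun x : ℝ => -((x:ℂ)/b + 1/b^2) * Complex.exp (-b * x)) atTop (𝓝 0) := by
  have e (x : ℝ) : ‖Complex.exp (-b*x)‖ = Real.exp (-b.re * x) := by
    rw [Complex.norm_exp]; simp
  have h1 : Tendsto (fun x : ℝ => (x:ℂ) * Complex.exp (-b * x)) atTop (𝓝 0) := by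
    rw [tendsto_zero_iff_norm_tendsto_zero]
    have := (tendsto_rpow_mul_exp_neg_mul_atTop_nhds_zero 1 b.re hb)
    refine (this.congr' ?_)
    filter_upwards [eventually_ge_atTop 0] with x hx
    rw [norm_mul, e, Complex.norm_real, Real.norm_of_nonneg hx, Real.rpow_one]
  have h2 : Tendsto (fun x : ℝ => Complex.exp (-b * x)) atTop (𝓝 0) := by
    rw [tendsto_zero_iff_norm_tendsto_zero]
    have := (tendsto_rpow_mul_exp_neg_mul_atTop_nhds_zero 0 b.re hb)
    refine (this.congr' ?_)
    filter_upwards [eventually_ge_atTop 0] with x hx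
    rw [e, Real.rpow_zero, one_mul]
  have := (h1.const_mul (-1/b)).add (h2.const_mul (-1/b^2))
  simp only [mul_zero, add_zero] at this
  refine this.congr fun x => ?_
  ring

lemma integ_xe {b : ℂ} (hb : 0 < b.re) :
    IntegrableOn (fun x : ℝ => (x:ℂ) * Complex.exp (-b * x)) (Set.Ioi 0) := by
  have := integrableOn_rpow_mul_exp_neg_mul_rpow (p := 1) (s := 1) (by norm_num) one_pos hb
  refine Integrable.mono' this (Continuous.aestronglyMeasurable (by fun_prop)) ?_
  filter_upwards [ae_restrict_mem measurableSet_Ioi] with x hx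
  have hx : 0 < x := hx
  rw [norm_mul, Complex.norm_real, Real.norm_of_nonneg hx.le, Complex.norm_exp]
  simp

lemma int_xe {b : ℂ} (hb : 0 < b.re) :
    ∫ x in Set.Ioi (0:ℝ), (x:ℂ) * Complex.exp (-b * x) = 1/b^2 := by
  have hb0 : b ≠ 0 := by rintro rfl; simp at hb
  have := integral_Ioi_of_hasDerivAt_of_tendsto (a := (0:ℝ)) (m := (0:ℂ))
    (f := fun x : ℝ => -((x:ℂ)/b + 1/b^2) * Complex.exp (-b * x))
    (f' := fun x : ℝ => (x:ℂ) * Complex.exp (-b * x))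
    (Continuous.continuousWithinAt (by fun_prop)) (fun x _ => ?_) (integ_xe hb) (expmul_tendsto hb)
  · rw [this]; simp
  · have hx : HasDerivAt (fun x : ℝ => (x:ℂ)) 1 x := Complex.ofRealCLM.hasDerivAt
    have := ((hx.div_const b).add_const (1/b^2)).neg.mul (hx.const_mul (-b)).cexp
    refine this.congr_deriv ?_
    simp
    field_simp
    ring

noncomputable def ff (a : ℂ) (x : ℝ) : ℂ := if 0 < x then (x:ℂ) * Complex.exp (-a * x) else 0

lemma ff_cont (a : ℂ) : Continuous (ff a) := by
  have : ff a = fun x : ℝ => ((max x 0 : ℝ):ℂ) * Complex.exp (-a * x) := by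
    ext x
    unfold ff
    split_ifs with h
    · rw [max_eq_left h.le]
    · rw [max_eq_right (not_lt.1 h)]; simp
  rw [this]; fun_prop

lemma ff_ind (a : ℂ) : ff a = (Set.Ioi (0:ℝ)).indicator (fun x : ℝ => (x:ℂ) * Complex.exp (-a * x)) := by
  ext x; simp [ff, Set.indicator]

lemma ff_int {a : ℂ} (ha : 0 < a.re) : Integrable (ff a) := by
  rw [ff_ind, integrable_indicator_iff measurableSet_Ioi]; exact integ_xe ha

open FourierTransform in
lemma ff_four {a : ℂ} (ha : 0 < a.re) (w : ℝ) :
    𝓕 (ff a) w = 1 / (a + ((2*Real.pi*w : ℝ):ℂ) * Complex.I)^2 := by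
  rw [Real.fourier_real_eq_integral_exp_smul, ← int_xe (b := a + ((2*Real.pi*w : ℝ):ℂ) * Complex.I) (by simpa using ha),
    ← integral_indicator measurableSet_Ioi]
  congr 1; ext x
  rw [ff_ind]
  by_cases hx : x ∈ Set.Ioi (0:ℝ)
  · simp only [Set.indicator_of_mem hx, smul_eq_mul]
    rw [mul_left_comm, ← Complex.exp_add]
    congr 2; push_cast; ring
  · simp [Set.indicator_of_notMem hx]

open FourierTransform in
lemma key {a : ℂ} (ha : 0 < a.re) (c : ℝ) :
    ∫ u : ℝ, Complex.exp ((u:ℂ) * Complex.I * c) / (a + (u:ℂ) * Complex.I)^2 = 2 * Real.pi * ff a c := by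
  have h2 : 𝓕 (ff a) = fun w : ℝ => 1 / (a + ((2*Real.pi*w : ℝ):ℂ) * Complex.I)^2 := funext (ff_four ha)
  have h3 : Integrable (𝓕 (ff a)) := by
    rw [h2]; exact (integ2 ha).comp_mul_left' (by positivity)
  have h4 := congrFun ((ff_cont a).fourierInv_fourier_eq (ff_int ha) h3) c
  rw [← h4, Real.fourierInv_eq', h2]
  have := Measure.integral_comp_mul_left (fun u : ℝ => Complex.exp ((u:ℂ) * Complex.I * c) / (a + (u:ℂ) * Complex.I)^2) (2*Real.pi)
  have e : (∫ v : ℝ, Complex.exp (↑(2 * Real.pi * inner ℝ v c) * Complex.I) • (fun w : ℝ => 1 / (a + ((2*Real.pi*w : ℝ):ℂ) * Complex.I)^2) v) = 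
    ∫ x : ℝ, (fun u : ℝ => Complex.exp ((u:ℂ) * Complex.I * c) / (a + (u:ℂ) * Complex.I)^2) (2*Real.pi*x) := by
    congr 1; ext v
    simp only [smul_eq_mul, mul_one_div]
    congr 2
    simp; ring
  rw [e, this, abs_of_pos (by positivity)]
  have : (Real.pi:ℂ) ≠ 0 := by exact_mod_cast Real.pi_ne_zero
  rw [Complex.real_smul]; push_cast
  rw [← mul_assoc, mul_inv_cancel₀ (mul_ne_zero two_ne_zero this), one_mul]

lemma bdry {a : ℂ} (ha : 0 < a.re) (c ε : ℝ) (l : Filter ℝ) (hl : Tendsto (fun x : ℝ => |x|) l atTop) :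
    Tendsto (fun u : ℝ => Complex.exp (((ε:ℂ) + (u:ℂ)*Complex.I) * (c:ℂ)) / (a + (u:ℂ)*Complex.I)) l (𝓝 0) := by
  rw [tendsto_zero_iff_norm_tendsto_zero]
  have h : Tendsto (fun u : ℝ => ‖a + (u:ℂ)*Complex.I‖) l atTop := by
    refine tendsto_atTop_mono (fun u => ?_) (tendsto_atTop_add_const_right l (-|a.im|) hl)
    have h1 := Complex.abs_im_le_norm (a + (u:ℂ)*Complex.I)
    simp at h1
    have h2 := abs_sub_abs_le_abs_add u a.im
    rw [add_comm] at h1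
    linarith
  have := h.inv_tendsto_atTop.const_mul (Real.exp (ε * c))
  rw [mul_zero] at this
  refine this.congr fun u => ?_
  rw [norm_div, Complex.norm_exp]
  simp [div_eq_mul_inv]

lemma main {ε : ℝ} {s : ℂ} (hs : s.re < ε) {c : ℝ} (hc : c ≠ 0) :
    Tendsto (fun R : ℝ => (1/(2*(Real.pi:ℂ))) *
        ∫ u in (-R)..R,
          Complex.exp (((ε:ℂ) + (u:ℂ)*Complex.I) * (c:ℂ)) / ((ε:ℂ) + (u:ℂ)*Complex.I - s))
      atTop (𝓝 (Complex.exp (ε * c) * ff (ε - s) c / c)) := by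
  set a : ℂ := ε - s with hadef
  have ha : 0 < a.re := by simp [hadef]; linarith
  have hc' : (c:ℂ) ≠ 0 := by exact_mod_cast hc
  have hpi : (Real.pi:ℂ) ≠ 0 := by exact_mod_cast Real.pi_ne_zero
  have hn := ne0 ha
  set G : ℝ → ℂ := fun u => Complex.exp (((ε:ℂ) + (u:ℂ)*Complex.I) * (c:ℂ)) / (a + (u:ℂ)*Complex.I)
  set H : ℝ → ℂ := fun u => Complex.exp (((ε:ℂ) + (u:ℂ)*Complex.I) * (c:ℂ)) / (a + (u:ℂ)*Complex.I)^2
  have hG : Continuous G := Continuous.div (by fun_prop) (by fun_prop) hn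
  have hH : Continuous H := Continuous.div (by fun_prop) (by fun_prop) fun u => pow_ne_zero 2 (hn u)
  have hHe : H = fun u : ℝ => Complex.exp (ε * c) * (Complex.exp ((u:ℂ) * Complex.I * c) / (a + (u:ℂ) * Complex.I)^2) := by
    ext u
    simp only [H, add_mul (ε:ℂ), Complex.exp_add]
    ring
  have hHint : Integrable H := by
    refine ((integ2 ha).norm.const_mul (Real.exp (ε*c))).mono' hH.aestronglyMeasurable (ae_of_all _ fun u => ?_)
    simp only [H]
    rw [norm_div, Complex.norm_exp]
    simp [div_eq_mul_inv]
  have hHval : ∫ u, H u = Complex.exp (ε * c) * (2 * Real.pi * ff a c) := by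
    rw [hHe, integral_const_mul, key ha]
  have hd (u : ℝ) : HasDerivAt G (Complex.I * c * G u - Complex.I * H u) u := by
    have hx : HasDerivAt (fun x : ℝ => (x:ℂ)) 1 u := Complex.ofRealCLM.hasDerivAt
    have h1 := (hx.mul_const Complex.I)
    have := (((h1.const_add (ε:ℂ)).mul_const (c:ℂ)).cexp).div (h1.const_add a) (hn u)
    refine this.congr_deriv ?_
    simp only [G, H]
    have := hn u
    field_simp
  have hF (R : ℝ) : ∫ u in (-R)..R, G u = (G R - G (-R)) / (Complex.I * c) + (∫ u in (-R)..R, H u) / c := by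
    have h1 := intervalIntegral.integral_eq_sub_of_hasDerivAt (a := -R) (b := R) (fun u _ => hd u)
      (Continuous.intervalIntegrable (by fun_prop) _ _)
    rw [intervalIntegral.integral_sub (Continuous.intervalIntegrable (by fun_prop) _ _) (Continuous.intervalIntegrable (by fun_prop) _ _),
      intervalIntegral.integral_const_mul, intervalIntegral.integral_const_mul] at h1
    rw [← h1]
    have := Complex.I_ne_zero
    field_simp
    ring
  have hlim := intervalIntegral_tendsto_integral hHint tendsto_neg_atTop_atBot tendsto_id
  have hb1 := bdry ha c ε atTop tendsto_abs_atTop_atTop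
  have hb2 := (bdry ha c ε atBot tendsto_abs_atBot_atTop).comp tendsto_neg_atTop_atBot
  have := (((hb1.sub hb2).div_const (Complex.I * c)).add (hlim.div_const (c:ℂ))).const_mul (1/(2*(Real.pi:ℂ)))
  rw [hHval] at this
  convert this using 2 with R
  · rw [show (fun u : ℝ => Complex.exp (((ε:ℂ) + (u:ℂ)*Complex.I) * (c:ℂ)) / ((ε:ℂ) + (u:ℂ)*Complex.I - s)) = G from ?_]
    · rw [hF]; rfl
    · ext u; simp only [G, hadef]; congr 1; ring
  · field_simp; simp

/-- Fourier–Laplace inversion on a vertical line: for `Re s < ε`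
and `c ≠ 0`, the principal-value integral
`(1/2π) ∫_{-R}^{R} e^{(ε+iu)c}/(ε+iu-s) du` converges as `R → ∞` to `e^{sc}`
if `c > 0`, and to `0` if `c < 0`. -/
theorem vertical_line_laplace_inversion
    (ε : ℝ) (hε : 0 < ε) (s : ℂ) (hs : s.re < ε) (c : ℝ) (hc : c ≠ 0) :
    (0 < c → Tendsto (fun R : ℝ => (1/(2*(Real.pi:ℂ))) *
        ∫ u in (-R)..R,
          Complex.exp (((ε:ℂ) + (u:ℂ)*Complex.I) * (c:ℂ)) / ((ε:ℂ) + (u:ℂ)*Complex.I - s))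
      atTop (𝓝 (Complex.exp (s * (c:ℂ)))))
    ∧ (c < 0 → Tendsto (fun R : ℝ => (1/(2*(Real.pi:ℂ))) *
        ∫ u in (-R)..R,
          Complex.exp (((ε:ℂ) + (u:ℂ)*Complex.I) * (c:ℂ)) / ((ε:ℂ) + (u:ℂ)*Complex.I - s))
      atTop (𝓝 0)) := by
  have h := main hs hc
  have hc' : (c:ℂ) ≠ 0 := by exact_mod_cast hc
  refine ⟨fun hp => ?_, fun hp => ?_⟩
  · convert h using 2
    rw [ff, if_pos hp, mul_left_comm, ← Complex.exp_add, mul_div_cancel_left₀ _ hc']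
    congr 1; ring
  · convert h using 2
    rw [ff, if_neg (not_lt.2 hp.le)]; simp
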